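/- Let M ⊆ {1,…,s} be a cover, let u = (0,1), and set Z₀ = W ∪ {(i·s,2) : i ∈ M}. Then, for the update family 𝒰_S, the closure [H_u ∪ Z₀] contains the whole line l_u = ℤ×{0}; in particular [H_u ∪ Z₀]∖H_u is infinite and α(u) ≤ s² + s + |M|. -/

import Mathlib

open scoped Classical

/-- A site of the two-dimensional lattice. -/
abbrev Site : Type := ℤ × ℤ

/-- An update family: a finite nonempty collection of finite nonempty rules,
none containing the origin. We represent the collection as a `Finset (Finset Site)`
together with this well-formedness predicate. -/
def IsUpdateFamily (𝒰 : Finset (Finset Site)) : Prop :=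
  𝒰.Nonempty ∧ ∀ U ∈ 𝒰, U.Nonempty ∧ ((0, 0) : Site) ∉ U

/-- One step of the bootstrap percolation dynamics. -/
def bpStep (𝒰 : Finset (Finset Site)) (A : Set Site) : Set Site :=
  A ∪ {x : Site | ∃ U ∈ 𝒰, ∀ y ∈ U, x + y ∈ A}

/-- The configuration after `t` steps of the dynamics started from `A`. -/
def bpIter (𝒰 : Finset (Finset Site)) (A : Set Site) : ℕ → Set Site
  | 0 => A
  | n + 1 => bpStep 𝒰 (bpIter 𝒰 A n)

/-- The closure `[A]` of a set `A` under the bootstrap dynamics. -/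
def bpClosure (𝒰 : Finset (Finset Site)) (A : Set Site) : Set Site :=
  ⋃ n : ℕ, bpIter 𝒰 A n

/-- The unit circle `S¹ ⊆ ℝ²`. -/
def sphere2 : Set (ℝ × ℝ) := {u : ℝ × ℝ | u.1 ^ 2 + u.2 ^ 2 = 1}

/-- Inner product of a lattice site with a real vector. -/
def inner2 (x : Site) (u : ℝ × ℝ) : ℝ := (x.1 : ℝ) * u.1 + (x.2 : ℝ) * u.2

/-- The open half-plane `H_u` with outer normal `u`. -/
def halfPlane (u : ℝ × ℝ) : Set Site := {x : Site | inner2 x u < 0}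

/-- The lattice line `l_u` through the origin perpendicular to `u`. -/
def lineu (u : ℝ × ℝ) : Set Site := {x : Site | inner2 x u = 0}

/-- A direction `u` is unstable if some rule lies in `H_u`. -/
def Unstable (𝒰 : Finset (Finset Site)) (u : ℝ × ℝ) : Prop :=
  ∃ U ∈ 𝒰, (U : Set Site) ⊆ halfPlane u

/-- A direction of the unit circle is stable if it is not unstable. -/
def Stable (𝒰 : Finset (Finset Site)) (u : ℝ × ℝ) : Prop :=
  u ∈ sphere2 ∧ ¬ Unstable 𝒰 u

/-- The set of stable directions. -/
def stableSet (𝒰 : Finset (Finset Site)) : Set (ℝ × ℝ) := {u | Stable 𝒰 u}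

/-- An isolated stable direction: a stable direction not in the (topological)
closure of the set of other stable directions. -/
def IsolatedStable (𝒰 : Finset (Finset Site)) (u : ℝ × ℝ) : Prop :=
  Stable 𝒰 u ∧ u ∉ closure (stableSet 𝒰 \ {u})

/-- The open semicircle of the unit circle centred at the direction `v`. -/
def openSemicircle (v : ℝ × ℝ) : Set (ℝ × ℝ) :=
  {u ∈ sphere2 | 0 < u.1 * v.1 + u.2 * v.2}

/-- A family is supercritical if some open semicircle consists of unstable directions. -/
def Supercritical (𝒰 : Finset (Finset Site)) : Prop :=
  ∃ v ∈ sphere2, ∀ u ∈ openSemicircle v, Unstable 𝒰 u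

/-- A family is critical if it is not supercritical and some open semicircle
contains only finitely many stable directions. -/
def Critical (𝒰 : Finset (Finset Site)) : Prop :=
  ¬ Supercritical 𝒰 ∧ ∃ v ∈ sphere2, (stableSet 𝒰 ∩ openSemicircle v).Finite

/-- The difficulty `α(u)` of a direction: `0` for unstable directions, `∞` for
non-isolated stable directions, and for isolated stable directions the minimum
cardinality of a finite `Z ⊆ ℤ² ∖ H_u` such that `[H_u ∪ Z] ∖ H_u` is infinite. -/
noncomputable def dirDifficulty (𝒰 : Finset (Finset Site)) (u : ℝ × ℝ) : ℕ∞ :=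
  if Unstable 𝒰 u then 0
  else if IsolatedStable 𝒰 u then
    sInf {n : ℕ∞ | ∃ Z : Finset Site, (∀ z ∈ Z, z ∉ halfPlane u) ∧
      (bpClosure 𝒰 (halfPlane u ∪ (Z : Set Site)) \ halfPlane u).Infinite ∧ n = Z.card}
  else ⊤

/-- The difficulty `α(𝒰)` of an update family. -/
noncomputable def difficulty (𝒰 : Finset (Finset Site)) : ℕ∞ :=
  ⨅ v ∈ sphere2, ⨆ u ∈ openSemicircle v, dirDifficulty 𝒰 u

/-- The diameter `D` of an update family: `2 · max{‖x‖_∞ : x ∈ ⋃ U ∈ 𝒰, U}`. -/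
def famDiam (𝒰 : Finset (Finset Site)) : ℕ :=
  2 * 𝒰.sup (fun U => U.sup (fun x => max x.1.natAbs x.2.natAbs))

/-- The set `W = {(x,0) : 1 ≤ x ≤ s²} ∪ {(l·s,1) : 1 ≤ l ≤ s}`. -/
noncomputable def Wset (s : ℕ) : Finset Site :=
  (Finset.Icc 1 (s ^ 2)).image (fun x => ((x : ℤ), (0 : ℤ))) ∪
    (Finset.Icc 1 s).image (fun l => (((l * s : ℕ) : ℤ), (1 : ℤ)))

/-- The set `T = {(0,−y) : 1 ≤ y ≤ N·s²}`. -/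
noncomputable def Tset (N s : ℕ) : Finset Site :=
  (Finset.Icc 1 (N * s ^ 2)).image (fun y => ((0 : ℤ), -(y : ℤ)))

/-- The rule `U₀ = {(−k,0) : 1 ≤ k ≤ N·s²} ∪ {(0,−k) : 1 ≤ k ≤ N·s²}`. -/
noncomputable def Urule0 (N s : ℕ) : Finset Site :=
  (Finset.Icc 1 (N * s ^ 2)).image (fun k => (-(k : ℤ), (0 : ℤ))) ∪
    (Finset.Icc 1 (N * s ^ 2)).image (fun k => ((0 : ℤ), -(k : ℤ)))

/-- The rule `U₁ = {(k,0) : 1 ≤ k ≤ N·s²} ∪ {(0,−k) : 1 ≤ k ≤ N·s²}`. -/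
noncomputable def Urule1 (N s : ℕ) : Finset Site :=
  (Finset.Icc 1 (N * s ^ 2)).image (fun k => ((k : ℤ), (0 : ℤ))) ∪
    (Finset.Icc 1 (N * s ^ 2)).image (fun k => ((0 : ℤ), -(k : ℤ)))

/-- The rule `U_{i,j}^k = T ∪ ((W ∪ {(i·s,2)}) − (k+(N+j)·s², 0))`. -/
noncomputable def Uijk (N s i j k : ℕ) : Finset Site :=
  Tset N s ∪
    (Wset s ∪ {(((i * s : ℕ) : ℤ), (2 : ℤ))}).image
      (fun w => w - (((k + (N + j) * s ^ 2 : ℕ) : ℤ), (0 : ℤ)))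

/-- The update family `𝒰_S = {U₀,U₁} ∪ {U_{i,j}^k : 1 ≤ i ≤ s, j ∈ S_i, 1 ≤ k ≤ s²}`
associated to a set cover instance `S`. -/
noncomputable def famS (N s : ℕ) (S : ℕ → Finset ℕ) : Finset (Finset Site) :=
  {Urule0 N s, Urule1 N s} ∪
    (((Finset.Icc 1 s ×ˢ Finset.Icc 1 N ×ˢ Finset.Icc 1 (s ^ 2)).filter
        (fun t => t.2.1 ∈ S t.1)).image (fun t => Uijk N s t.1 t.2.1 t.2.2))

/-- `M` is a cover of the set cover instance `S_1, …, S_s` over `{1,…,N}`. -/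
def IsCover (N s : ℕ) (S : ℕ → Finset ℕ) (M : Finset ℕ) : Prop :=
  M ⊆ Finset.Icc 1 s ∧ M.biUnion S = Finset.Icc 1 N

theorem bpIter_mono (𝒰 : Finset (Finset Site)) (A : Set Site) : Monotone (bpIter 𝒰 A) :=
  monotone_nat_of_le_succ fun _ => Set.subset_union_left

theorem subset_bpClosure (𝒰 : Finset (Finset Site)) (A : Set Site) : A ⊆ bpClosure 𝒰 A :=
  Set.subset_iUnion (bpIter 𝒰 A) 0

/-- The closure is stable under every rule, because rules are finite. -/
theorem mem_bpClosure_of_rule {𝒰 : Finset (Finset Site)} {A : Set Site} {U : Finset Site}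
    (hU : U ∈ 𝒰) {x : Site} (h : ∀ y ∈ U, x + y ∈ bpClosure 𝒰 A) : x ∈ bpClosure 𝒰 A := by
  have h' : ∀ y ∈ U, ∃ n, x + y ∈ bpIter 𝒰 A n := fun y hy => Set.mem_iUnion.1 (h y hy)
  choose! f hf using h'
  refine Set.mem_iUnion.2 ⟨U.sup f + 1, Or.inr ⟨U, hU, fun y hy => ?_⟩⟩
  exact bpIter_mono 𝒰 A (Finset.le_sup hy) (hf y hy)

theorem mem_halfPlane_up {x : Site} : x ∈ halfPlane ((0 : ℝ), (1 : ℝ)) ↔ x.2 < 0 := by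
  simp [halfPlane, inner2]

theorem mem_lineu_up {x : Site} : x ∈ lineu ((0 : ℝ), (1 : ℝ)) ↔ x.2 = 0 := by
  simp [lineu, inner2]

theorem mem_Tset {N s : ℕ} {y : Site} (hy : y ∈ Tset N s) :
    ∃ k : ℕ, (1 ≤ k ∧ k ≤ N * s ^ 2) ∧ ((0 : ℤ), -(k : ℤ)) = y := by
  simpa [Tset] using hy

theorem mem_Urule0 {N s : ℕ} {y : Site} (hy : y ∈ Urule0 N s) :
    (∃ k : ℕ, (1 ≤ k ∧ k ≤ N * s ^ 2) ∧ (-(k : ℤ), (0 : ℤ)) = y) ∨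
      ∃ k : ℕ, (1 ≤ k ∧ k ≤ N * s ^ 2) ∧ ((0 : ℤ), -(k : ℤ)) = y := by
  simpa [Urule0] using hy

theorem mem_Urule1 {N s : ℕ} {y : Site} (hy : y ∈ Urule1 N s) :
    (∃ k : ℕ, (1 ≤ k ∧ k ≤ N * s ^ 2) ∧ ((k : ℤ), (0 : ℤ)) = y) ∨
      ∃ k : ℕ, (1 ≤ k ∧ k ≤ N * s ^ 2) ∧ ((0 : ℤ), -(k : ℤ)) = y := by
  simpa [Urule1] using hy

theorem Urule0_mem_famS (N s : ℕ) (S : ℕ → Finset ℕ) : Urule0 N s ∈ famS N s S := by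
  simp [famS]

theorem Urule1_mem_famS (N s : ℕ) (S : ℕ → Finset ℕ) : Urule1 N s ∈ famS N s S := by
  simp [famS]

theorem unstable_famS_of_pos {N s : ℕ} {S : ℕ → Finset ℕ} {u : ℝ × ℝ} (h₁ : u.1 ≠ 0)
    (h₂ : 0 < u.2) : Unstable (famS N s S) u := by
  rcases lt_or_gt_of_ne h₁ with h₁ | h₁
  · refine ⟨_, Urule1_mem_famS N s S, fun x hx => ?_⟩
    rcases mem_Urule1 hx with ⟨k, ⟨hk, -⟩, rfl⟩ | ⟨k, ⟨hk, -⟩, rfl⟩ <;>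
    · have : (0 : ℝ) < k := by exact_mod_cast hk
      simp only [halfPlane, inner2, Set.mem_ofPred_eq]
      push_cast
      nlinarith
  · refine ⟨_, Urule0_mem_famS N s S, fun x hx => ?_⟩
    rcases mem_Urule0 hx with ⟨k, ⟨hk, -⟩, rfl⟩ | ⟨k, ⟨hk, -⟩, rfl⟩ <;>
    · have : (0 : ℝ) < k := by exact_mod_cast hk
      simp only [halfPlane, inner2, Set.mem_ofPred_eq]
      push_cast
      nlinarith

theorem isolatedStable_famS_up {N s : ℕ} {S : ℕ → Finset ℕ}
    (h : ¬ Unstable (famS N s S) ((0 : ℝ), (1 : ℝ))) :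
    IsolatedStable (famS N s S) ((0 : ℝ), (1 : ℝ)) := by
  refine ⟨⟨by simp [sphere2], h⟩, fun hcl => ?_⟩
  have hopen : IsOpen {v : ℝ × ℝ | 0 < v.2} := isOpen_lt continuous_const continuous_snd
  obtain ⟨v, hv, ⟨hvs, hvu⟩, hne⟩ := mem_closure_iff.1 hcl _ hopen (by simp)
  simp only [Set.mem_ofPred_eq] at hv
  by_cases h₁ : v.1 = 0
  · apply hne
    simp only [sphere2, Set.mem_ofPred_eq, h₁] at hvs
    have : v.2 = 1 := by nlinarith
    exact Prod.ext h₁ this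
  · exact hvu (unstable_famS_of_pos h₁ hv)

section Growth

variable {N s : ℕ} {S : ℕ → Finset ℕ} {A : Set Site}

theorem below_mem_bpClosure (hA : halfPlane ((0 : ℝ), (1 : ℝ)) ⊆ A) (p : ℤ) {k : ℕ}
    (hk : 1 ≤ k) : ((p, 0) : Site) + ((0 : ℤ), -(k : ℤ)) ∈ bpClosure (famS N s S) A := by
  refine subset_bpClosure _ _ (hA (mem_halfPlane_up.2 ?_))
  simp only [Prod.snd_add]
  omega

/-- A block of `N·s²` consecutive sites on the line grows to the right. -/
theorem right_growth (hA : halfPlane ((0 : ℝ), (1 : ℝ)) ⊆ A) (a : ℤ)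
    (hblock : ∀ p : ℤ, a < p → p ≤ a + (N * s ^ 2 : ℕ) → (p, 0) ∈ bpClosure (famS N s S) A)
    (n : ℕ) : (a + 1 + n, 0) ∈ bpClosure (famS N s S) A := by
  induction n using Nat.strong_induction_on with
  | _ n ih =>
    by_cases hn : n < N * s ^ 2
    · exact hblock _ (by omega) (by omega)
    · refine mem_bpClosure_of_rule (Urule0_mem_famS N s S) fun y hy => ?_
      rcases mem_Urule0 hy with ⟨k, ⟨hk, hk'⟩, rfl⟩ | ⟨k, ⟨hk, -⟩, rfl⟩
      · convert ih (n - k) (by omega) using 1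
        ext
        · simp only [Prod.fst_add]
          omega
        · simp
      · exact below_mem_bpClosure hA _ hk

/-- A block of `N·s²` consecutive sites on the line grows to the left. -/
theorem left_growth (hA : halfPlane ((0 : ℝ), (1 : ℝ)) ⊆ A) (a : ℤ)
    (hblock : ∀ p : ℤ, a < p → p ≤ a + (N * s ^ 2 : ℕ) → (p, 0) ∈ bpClosure (famS N s S) A)
    (n : ℕ) : (a + (N * s ^ 2 : ℕ) - n, 0) ∈ bpClosure (famS N s S) A := by
  induction n using Nat.strong_induction_on with
  | _ n ih =>
    by_cases hn : n < N * s ^ 2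
    · exact hblock _ (by omega) (by omega)
    · refine mem_bpClosure_of_rule (Urule1_mem_famS N s S) fun y hy => ?_
      rcases mem_Urule1 hy with ⟨k, ⟨hk, hk'⟩, rfl⟩ | ⟨k, ⟨hk, -⟩, rfl⟩
      · convert ih (n - k) (by omega) using 1
        ext
        · simp only [Prod.fst_add]
          omega
        · simp
      · exact below_mem_bpClosure hA _ hk

theorem line_mem_of_block (hA : halfPlane ((0 : ℝ), (1 : ℝ)) ⊆ A) (a : ℤ)
    (hblock : ∀ p : ℤ, a < p → p ≤ a + (N * s ^ 2 : ℕ) → (p, 0) ∈ bpClosure (famS N s S) A)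
    (p : ℤ) : (p, 0) ∈ bpClosure (famS N s S) A := by
  rcases lt_or_ge a p with h | h
  · convert right_growth hA a hblock (p - a - 1).toNat using 2
    omega
  · convert left_growth hA a hblock (a + (N * s ^ 2 : ℕ) - p).toNat using 2
    omega

theorem mem_bpClosure_of_Uijk (hA : halfPlane ((0 : ℝ), (1 : ℝ)) ⊆ A)
    (hW : ∀ w ∈ Wset s, w ∈ A) {i j k : ℕ} (hi : i ∈ Finset.Icc 1 s)
    (hiA : (((i * s : ℕ) : ℤ), (2 : ℤ)) ∈ A) (hj : j ∈ Finset.Icc 1 N) (hij : j ∈ S i)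
    (hk : k ∈ Finset.Icc 1 (s ^ 2)) :
    (((k + (N + j) * s ^ 2 : ℕ) : ℤ), (0 : ℤ)) ∈ bpClosure (famS N s S) A := by
  have hU : Uijk N s i j k ∈ famS N s S :=
    Finset.mem_union_right _ (Finset.mem_image.2 ⟨(i, j, k), by
      simp only [Finset.mem_filter, Finset.mem_product]
      exact ⟨⟨hi, hj, hk⟩, hij⟩, rfl⟩)
  refine mem_bpClosure_of_rule hU fun y hy => ?_
  rcases Finset.mem_union.1 hy with hy | hy
  · obtain ⟨m, hm, rfl⟩ := mem_Tset hy
    exact below_mem_bpClosure hA _ hm.1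
  · obtain ⟨w, hw, rfl⟩ := Finset.mem_image.1 hy
    rw [add_sub_cancel]
    apply subset_bpClosure
    rcases Finset.mem_union.1 hw with hw | hw
    · exact hW w hw
    · rwa [Finset.mem_singleton.1 hw]

end Growth

/-- The half-plane together with `Z₀` fills the whole line. -/
theorem line_mem_bpClosure {N s : ℕ} {S : ℕ → Finset ℕ} {M : Finset ℕ} {A : Set Site} (hs : 1 ≤ s)
    (hM : IsCover N s S M) (hA : halfPlane ((0 : ℝ), (1 : ℝ)) ⊆ A) (hW : ∀ w ∈ Wset s, w ∈ A)
    (hMA : ∀ i ∈ M, (((i * s : ℕ) : ℤ), (2 : ℤ)) ∈ A) (p : ℤ) :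
    (p, 0) ∈ bpClosure (famS N s S) A := by
  refine line_mem_of_block hA ((N + 1) * s ^ 2 : ℕ) (fun p hp hp' => ?_) p
  lift p to ℕ using by omega
  obtain ⟨q, rfl⟩ : ∃ q, p = (N + 1) * s ^ 2 + 1 + q :=
    Nat.exists_eq_add_of_le (by omega)
  have hpos : 0 < s ^ 2 := by positivity
  have hq : q / s ^ 2 < N := Nat.div_lt_of_lt_mul (by rw [mul_comm]; omega)
  have hj : q / s ^ 2 + 1 ∈ Finset.Icc 1 N := Finset.mem_Icc.2 ⟨Nat.le_add_left .., hq⟩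
  have hj' := hj
  rw [← hM.2] at hj'
  obtain ⟨i, hiM, hij⟩ := Finset.mem_biUnion.1 hj'
  have hk : q % s ^ 2 + 1 ∈ Finset.Icc 1 (s ^ 2) :=
    Finset.mem_Icc.2 ⟨Nat.le_add_left .., Nat.mod_lt _ hpos⟩
  have h := mem_bpClosure_of_Uijk hA hW (hM.1 hiM) (hMA i hiM) hj hij hk
  have he : q % s ^ 2 + 1 + (N + (q / s ^ 2 + 1)) * s ^ 2 = (N + 1) * s ^ 2 + 1 + q := by
    conv_rhs => rw [← Nat.mod_add_div q (s ^ 2)]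
    ring
  rwa [he] at h

/-- for a cover `M` and `u = (0,1)`, the set
`Z₀ = W ∪ {(i·s,2) : i ∈ M}` satisfies `l_u ⊆ [H_u ∪ Z₀]`; in particular
`[H_u ∪ Z₀] ∖ H_u` is infinite and `α(u) ≤ s² + s + |M|`. -/
theorem famS_upper_bound (N s : ℕ) (hN : 4 ≤ N) (hs : 4 ≤ s)
    (S : ℕ → Finset ℕ) (hS : ∀ i ∈ Finset.Icc 1 s, S i ⊆ Finset.Icc 1 N)
    (hcov : (Finset.Icc 1 s).biUnion S = Finset.Icc 1 N)
    (M : Finset ℕ) (hM : IsCover N s S M) :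
    lineu ((0 : ℝ), (1 : ℝ)) ⊆
      bpClosure (famS N s S) (halfPlane ((0 : ℝ), (1 : ℝ)) ∪
        ((Wset s ∪ M.image (fun i : ℕ => (((i * s : ℕ) : ℤ), (2 : ℤ))) : Finset Site) : Set Site)) ∧
    (bpClosure (famS N s S) (halfPlane ((0 : ℝ), (1 : ℝ)) ∪
        ((Wset s ∪ M.image (fun i : ℕ => (((i * s : ℕ) : ℤ), (2 : ℤ))) : Finset Site) : Set Site))
      \ halfPlane ((0 : ℝ), (1 : ℝ))).Infinite ∧
    dirDifficulty (famS N s S) ((0 : ℝ), (1 : ℝ)) ≤ ((s ^ 2 + s + M.card : ℕ) : ℕ∞) := by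
  have hW : ∀ w ∈ Wset s, 0 ≤ w.2 := by
    intro w hw
    simp only [Wset, Finset.mem_union, Finset.mem_image] at hw
    rcases hw with ⟨_, _, rfl⟩ | ⟨_, _, rfl⟩ <;> simp
  set Z : Finset Site := Wset s ∪ M.image (fun i : ℕ => (((i * s : ℕ) : ℤ), (2 : ℤ))) with hZ
  have hline : ∀ p : ℤ, (p, 0) ∈ bpClosure (famS N s S)
      (halfPlane ((0 : ℝ), (1 : ℝ)) ∪ (Z : Set Site)) :=
    line_mem_bpClosure (by omega) hM Set.subset_union_left
      (fun w hw => Or.inr (Finset.mem_coe.2 (Finset.mem_union_left _ hw)))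
      (fun i hi => Or.inr (Finset.mem_coe.2
        (Finset.mem_union_right _ (Finset.mem_image.2 ⟨i, hi, rfl⟩))))
  have hinf : (bpClosure (famS N s S) (halfPlane ((0 : ℝ), (1 : ℝ)) ∪ (Z : Set Site))
      \ halfPlane ((0 : ℝ), (1 : ℝ))).Infinite := by
    refine Set.infinite_of_injective_forall_mem (f := fun p : ℤ => ((p, 0) : Site))
      (fun p q h => congrArg Prod.fst h) fun p => ⟨hline p, ?_⟩
    simp [mem_halfPlane_up]
  refine ⟨?_, hinf, ?_⟩
  · rintro ⟨p, q⟩ hx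
    obtain rfl : q = 0 := mem_lineu_up.1 hx
    exact hline p
  · have hcard : Z.card ≤ s ^ 2 + s + M.card := by
      refine (Finset.card_union_le _ _).trans (add_le_add ?_ Finset.card_image_le)
      refine (Finset.card_union_le _ _).trans (add_le_add ?_ ?_)
      · refine Finset.card_image_le.trans ?_
        simp only [Finset.bind_def, Finset.pure_def, Finset.sup_singleton_apply]
        exact (@Finset.card_image_le _ _ _ _ (_)).trans (by simp)
      · exact Finset.card_image_le.trans (by simp)
    unfold dirDifficulty
    split_ifs with h₁ h₂
    · exact zero_le
    · refine le_trans (b := (Z.card : ℕ∞)) (sInf_le ⟨Z, fun z hz => ?_, hinf, rfl⟩)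
        (by exact_mod_cast hcard)
      rw [mem_halfPlane_up, not_lt]
      rcases Finset.mem_union.1 hz with hz | hz
      · exact hW z hz
      · obtain ⟨i, _, rfl⟩ := Finset.mem_image.1 hz
        simp
    · exact absurd (isolatedStable_famS_up h₁) h₂
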